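/- Let p : ({-1,1}^n)^d → ℝ be a homogeneous block-multilinear polynomial of degree d (each monomial contains exactly one variable from each block) with completely bounded norm ‖p‖_cb ≤ 1. Then p has a variable of influence at least Var[p]². -/

import Mathlib

noncomputable section

/-- `E m` is the Euclidean space `ℝ^m`. -/
abbrev E (m : ℕ) := EuclideanSpace ℝ (Fin m)

/-- A block-multilinear polynomial `p : ({-1,1}^n)^d → ℝ` is encoded by its Fourier
coefficients `g : (Fin d → Option (Fin n)) → ℝ`: a set `S` of pairs `(block, coordinate)`
containing at most one pair from each block corresponds to the function `σ` with
`σ b = some i` iff `(b,i) ∈ S`.  `blockSize σ` is the cardinality `|S|`. -/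
def blockSize {n d : ℕ} (σ : Fin d → Option (Fin n)) : ℕ :=
  (Finset.univ.filter fun b => (σ b).isSome).card

/-- The evaluation `p(A_1,…,A_d)` of a block-multilinear polynomial on `n`-tuples of
operators: `Σ_S p̂(S) A_{b_1}(i_1)⋯A_{b_s}(i_s)` (with identity in the blocks not
occurring in `S`, giving the ordered product over blocks `b_1 < ⋯ < b_s`). -/
def blockEval {n d m : ℕ} (g : (Fin d → Option (Fin n)) → ℝ)
    (A : Fin d → Fin n → (E m →L[ℝ] E m)) : E m →L[ℝ] E m :=
  ∑ σ : Fin d → Option (Fin n),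
    g σ • (List.ofFn fun b => Option.elim (σ b) 1 fun i => A b i).prod

/-- The completely bounded norm `‖p‖_cb`: the supremum of `‖p(A_1,…,A_d)‖_op` over all
`m` and all tuples of operators of norm at most 1. -/
def cbNorm {n d : ℕ} (g : (Fin d → Option (Fin n)) → ℝ) : ℝ :=
  sSup { r | ∃ (m : ℕ) (A : Fin d → Fin n → (E m →L[ℝ] E m)),
    (∀ b i, ‖A b i‖ ≤ 1) ∧ r = ‖blockEval g A‖ }

/-- The influence of variable `(b,i)`: `Inf_{b,i}[p] = Σ_{S ∋ (b,i)} p̂(S)²`. -/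
def inflB {n d : ℕ} (g : (Fin d → Option (Fin n)) → ℝ) (b : Fin d) (i : Fin n) : ℝ :=
  ∑ σ ∈ Finset.univ.filter (fun σ : Fin d → Option (Fin n) => σ b = some i), g σ ^ 2

/-- The variance `Var[p] = Σ_{S ≠ ∅} p̂(S)²`. -/
def varB {n d : ℕ} (g : (Fin d → Option (Fin n)) → ℝ) : ℝ :=
  ∑ σ ∈ Finset.univ.filter
      (fun σ : Fin d → Option (Fin n) => σ ≠ fun _ => none), g σ ^ 2

open Finset

theorem sum_ite_comp_sq_le {ι : Type*} [Fintype ι] [DecidableEq ι] (P : ι → Prop)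
    [DecidablePred P] (f : ι → ι) (hf : Set.InjOn f {k | P k}) (x : ι → ℝ) :
    ∑ k, (if P k then x (f k) else 0) ^ 2 ≤ ∑ k, x k ^ 2 := by
  have hf' : Set.InjOn f (univ.filter P : Finset ι) := fun k hk l hl h =>
    hf (by simpa using hk) (by simpa using hl) h
  calc ∑ k, (if P k then x (f k) else 0) ^ 2 = ∑ k ∈ univ.filter P, x (f k) ^ 2 := by
        simp [ite_pow, sum_filter]
    _ = ∑ k ∈ (univ.filter P).image f, x k ^ 2 := (sum_image (f := fun k => x k ^ 2) hf').symm
    _ ≤ ∑ k, x k ^ 2 :=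
        sum_le_sum_of_subset_of_nonneg (subset_univ _) fun _ _ _ => sq_nonneg _

/-- The partial isometry of `E m` that pulls coordinates back along `f` on the set `P` where `f`
is injective, and vanishes off `P`. -/
def partialPullback {m : ℕ} (P : Fin m → Prop) [DecidablePred P] (f : Fin m → Fin m)
    (hf : Set.InjOn f {k | P k}) : E m →L[ℝ] E m :=
  LinearMap.mkContinuous
    { toFun := fun x => WithLp.toLp 2 fun k => if P k then x (f k) else 0
      map_add' := fun x y => by
        ext k
        by_cases h : P k <;> simp [h]
      map_smul' := fun c x => by
        ext k
        by_cases h : P k <;> simp [h] } 1 fun x => by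
    rw [one_mul]
    refine le_of_sq_le_sq ?_ (norm_nonneg _)
    rw [EuclideanSpace.real_norm_sq_eq, EuclideanSpace.real_norm_sq_eq]
    exact sum_ite_comp_sq_le P f hf x

theorem norm_partialPullback_le {m : ℕ} (P : Fin m → Prop) [DecidablePred P] (f : Fin m → Fin m)
    (hf : Set.InjOn f {k | P k}) : ‖partialPullback P f hf‖ ≤ 1 :=
  LinearMap.mkContinuous_norm_le _ zero_le_one _

theorem partialPullback_apply {m : ℕ} (P : Fin m → Prop) [DecidablePred P] (f : Fin m → Fin m)
    (hf : Set.InjOn f {k | P k}) (x : E m) (k : Fin m) :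
    partialPullback P f hf x k = if P k then x (f k) else 0 := rfl

theorem norm_list_prod_le_one {m : ℕ} (l : List (E m →L[ℝ] E m)) (h : ∀ a ∈ l, ‖a‖ ≤ 1) :
    ‖l.prod‖ ≤ 1 := by
  induction l with
  | nil => exact ContinuousLinearMap.norm_id_le
  | cons a l ih =>
    rw [List.prod_cons]
    have h₁ := h a (by simp)
    have h₂ := ih fun b hb => h b (by simp [hb])
    exact (norm_mul_le _ _).trans (mul_le_one₀ h₁ (norm_nonneg _) h₂)

theorem norm_blockEval_le {n d m : ℕ} (g : (Fin d → Option (Fin n)) → ℝ)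
    (A : Fin d → Fin n → (E m →L[ℝ] E m)) (hA : ∀ b i, ‖A b i‖ ≤ 1) :
    ‖blockEval g A‖ ≤ ∑ σ, |g σ| := by
  refine norm_sum_le_of_le _ fun σ _ => ?_
  rw [norm_smul, Real.norm_eq_abs]
  refine mul_le_of_le_one_right (abs_nonneg _) (norm_list_prod_le_one _ fun a ha => ?_)
  obtain ⟨b, rfl⟩ := (List.mem_ofFn' _ _).1 ha
  cases hσ : σ b with
  | none =>
    simp only [hσ, Option.elim_none]
    exact ContinuousLinearMap.norm_id_le
  | some i =>
    simp only [hσ, Option.elim_some]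
    exact hA b i

theorem norm_blockEval_le_cbNorm {n d m : ℕ} (g : (Fin d → Option (Fin n)) → ℝ)
    (A : Fin d → Fin n → (E m →L[ℝ] E m)) (hA : ∀ b i, ‖A b i‖ ≤ 1) :
    ‖blockEval g A‖ ≤ cbNorm g := by
  refine le_csSup ⟨∑ σ, |g σ|, ?_⟩ ⟨m, A, hA, rfl⟩
  rintro _ ⟨m', A', hA', rfl⟩
  exact norm_blockEval_le g A' hA'

section Fock

variable {n d m : ℕ} (e : Fin m ≃ (Fin d → Option (Fin n)))

/-- The basis vector of `E m` labelled by the partial monomial `σ`. -/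
def monomialVec (σ : Fin d → Option (Fin n)) : E m :=
  EuclideanSpace.single (e.symm σ) 1

theorem injOn_update_none (b : Fin d) (i : Fin n) :
    Set.InjOn (fun k => e.symm (Function.update (e k) b none)) {k | e k b = some i} := by
  intro k hk l hl h
  have h' := e.symm.injective h
  apply e.injective
  funext c
  by_cases hc : c = b
  · subst hc
    exact hk.trans hl.symm
  · simpa [hc] using congrFun h' c

/-- The creation operator that multiplies a partial monomial without a variable in block `b` by
the variable `(b, i)`. -/
def creation (b : Fin d) (i : Fin n) : E m →L[ℝ] E m :=
  partialPullback (fun k => e k b = some i) (fun k => e.symm (Function.update (e k) b none))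
    (injOn_update_none e b i)

theorem creation_monomialVec {b : Fin d} (i : Fin n) {τ : Fin d → Option (Fin n)}
    (hτ : τ b = none) :
    creation e b i (monomialVec e τ) = monomialVec e (Function.update τ b (some i)) := by
  ext k
  obtain ⟨ρ, rfl⟩ := e.symm.surjective k
  rw [creation, partialPullback_apply]
  simp only [monomialVec, PiLp.single_apply, Equiv.apply_symm_apply,
    EmbeddingLike.apply_eq_iff_eq]
  rw [← ite_and]
  refine if_congr ⟨?_, ?_⟩ rfl rfl
  · rintro ⟨h, rfl⟩
    simp [← h]
  · rintro rfl
    simp [← hτ]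

theorem list_prod_creation_monomialVec (A : Fin d → Fin n → (E m →L[ℝ] E m))
    (σ : Fin d → Option (Fin n)) (l : List (Fin d)) (hl : l.Nodup)
    (hA : ∀ b ∈ l, A b = creation e b) :
    (l.map fun b => Option.elim (σ b) 1 fun i => A b i).prod (monomialVec e fun _ => none) =
      monomialVec e fun b => if b ∈ l then σ b else none := by
  induction l with
  | nil => simp
  | cons a l ih =>
    obtain ⟨hal, hl⟩ := List.nodup_cons.1 hl
    rw [List.map_cons, List.prod_cons, mul_apply_eq_comp,
      ih hl fun b hb => hA b (by simp [hb])]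
    cases hσ : σ a with
    | none =>
      simp only [Option.elim_none, one_apply_eq_self]
      congr 1
      funext b
      by_cases hb : b = a
      · subst hb
        simp [hσ]
      · simp [hb]
    | some i =>
      rw [Option.elim_some, hA a (by simp), creation_monomialVec e i (by simp [hal])]
      congr 1
      funext b
      by_cases hb : b = a
      · subst hb
        simp [hσ]
      · simp [hb]

end Fock

/-- The slice of `g` at the variable `(b, i)`, viewed as a vector indexed by the monomials without
a variable in block `b`. -/
def sliceVec {n d m : ℕ} (e : Fin m ≃ (Fin d → Option (Fin n)))
    (g : (Fin d → Option (Fin n)) → ℝ) (b : Fin d) (i : Fin n) : E m :=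
  WithLp.toLp 2 fun k => if e k b = none then g (Function.update (e k) b (some i)) else 0

theorem norm_sliceVec_sq {n d m : ℕ} (e : Fin m ≃ (Fin d → Option (Fin n)))
    (g : (Fin d → Option (Fin n)) → ℝ) (b : Fin d) (i : Fin n) :
    ‖sliceVec e g b i‖ ^ 2 = inflB g b i := by
  rw [EuclideanSpace.real_norm_sq_eq, inflB]
  simp only [sliceVec, ite_pow, ne_eq, OfNat.ofNat_ne_zero, not_false_eq_true, zero_pow]
  rw [e.sum_comp fun τ => if τ b = none then g (Function.update τ b (some i)) ^ 2 else 0,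
    ← sum_filter]
  refine sum_bij' (fun τ _ => Function.update τ b (some i)) (fun σ _ => Function.update σ b none)
    ?_ ?_ ?_ ?_ ?_
  · simp
  · simp
  · intro τ hτ
    have : τ b = none := by simpa using hτ
    simp [← this]
  · intro σ hσ
    have : σ b = some i := by simpa using hσ
    simp [← this]
  · simp

theorem inner_sliceVec_monomialVec {n d m : ℕ} (e : Fin m ≃ (Fin d → Option (Fin n)))
    (g : (Fin d → Option (Fin n)) → ℝ) (b : Fin d) (i : Fin n) {τ : Fin d → Option (Fin n)}
    (hτ : τ b = none) :
    inner ℝ (sliceVec e g b i) (monomialVec e τ) = g (Function.update τ b (some i)) := by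
  simp [sliceVec, monomialVec, EuclideanSpace.inner_single_right, hτ]

theorem varB_eq_sum_sq {n d : ℕ} (hd : 0 < d) (g : (Fin d → Option (Fin n)) → ℝ)
    (hhom : ∀ σ : Fin d → Option (Fin n), (∃ b, σ b = none) → g σ = 0) :
    varB g = ∑ σ, g σ ^ 2 := by
  rw [varB, sum_filter]
  refine sum_congr rfl fun σ _ => ?_
  split_ifs with h
  · rfl
  · rw [hhom σ ⟨⟨0, hd⟩, by rw [not_not.1 h]⟩]
    simp

theorem varB_le_of_inflB_le {n d : ℕ} (g : (Fin (d + 1) → Option (Fin n)) → ℝ)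
    (hhom : ∀ σ : Fin (d + 1) → Option (Fin n), (∃ b, σ b = none) → g σ = 0)
    (hcb : cbNorm g ≤ 1) {r : ℝ} (hr : 0 < r) (hinf : ∀ i, inflB g 0 i ≤ r ^ 2) :
    varB g ≤ r := by
  let e := (Fintype.equivFin (Fin (d + 1) → Option (Fin n))).symm
  let Ω := monomialVec e fun _ => none
  have hΩ : ‖Ω‖ = 1 := by simp [Ω, monomialVec]
  let A : Fin (d + 1) → Fin n → (E _ →L[ℝ] E _) := fun b i =>
    if b = 0 then (innerSL ℝ (r⁻¹ • sliceVec e g 0 i)).smulRight Ω else creation e b i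
  have hA : ∀ b i, ‖A b i‖ ≤ 1 := by
    intro b i
    by_cases hb : b = 0
    · simp only [A, if_pos hb]
      rw [ContinuousLinearMap.norm_smulRight_apply, hΩ, mul_one, innerSL_apply_norm, norm_smul,
        norm_inv, Real.norm_of_nonneg hr.le, inv_mul_le_one₀ hr]
      exact le_of_sq_le_sq (by rw [norm_sliceVec_sq]; exact hinf i) hr.le
    · simp only [A, if_neg hb]
      exact norm_partialPullback_le _ _ _
  have hprod : ∀ σ, g σ • (List.ofFn fun b => Option.elim (σ b) 1 fun i => A b i).prod Ω =
      (r⁻¹ * g σ ^ 2) • Ω := by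
    intro σ
    cases hσ : σ 0 with
    | none => simp [hhom σ ⟨0, hσ⟩]
    | some i =>
      have hl : ((List.finRange d).map Fin.succ).Nodup :=
        (List.nodup_finRange d).map (Fin.succ_injective d)
      have htail := list_prod_creation_monomialVec e A σ _ hl (by
        intro b hb
        obtain ⟨c, -, rfl⟩ := List.mem_map.1 hb
        funext i
        simp [A, Fin.succ_ne_zero])
      rw [List.ofFn_eq_map, List.finRange_succ, List.map_cons, List.prod_cons,
        mul_apply_eq_comp, htail, hσ, Option.elim_some]
      have hupd : Function.update
          (fun b => if b ∈ (List.finRange d).map Fin.succ then σ b else none) 0 (some i) = σ := by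
        funext b
        refine Fin.cases ?_ (fun c => ?_) b
        · simp [hσ]
        · simp [Fin.succ_ne_zero]
      simp only [A, if_true, ContinuousLinearMap.smulRight_apply, innerSL_apply_apply]
      rw [real_inner_smul_left, inner_sliceVec_monomialVec e g 0 i (by simp), hupd, smul_smul]
      congr 1
      ring
  have heval : blockEval g A Ω = (r⁻¹ * varB g) • Ω := by
    rw [varB_eq_sum_sq d.succ_pos g hhom, mul_sum, sum_smul, blockEval,
      _root_.sum_apply]
    exact sum_congr rfl fun σ _ => hprod σ
  have hle : ‖(r⁻¹ * varB g) • Ω‖ ≤ 1 := by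
    rw [← heval]
    refine (ContinuousLinearMap.le_opNorm _ _).trans ?_
    rw [hΩ, mul_one]
    exact (norm_blockEval_le_cbNorm g A hA).trans hcb
  rw [norm_smul, hΩ, mul_one] at hle
  exact (inv_mul_le_one₀ hr).1 ((le_abs_self _).trans hle)

/-- A homogeneous block-multilinear polynomial of degree `d`
(each monomial has exactly one variable from each block) with `‖p‖_cb ≤ 1`
has a variable of influence at least `Var[p]²`. -/
theorem stmt_4 {n d : ℕ} (hn : 0 < n) (hd : 0 < d)
    (g : (Fin d → Option (Fin n)) → ℝ)
    (hhom : ∀ σ : Fin d → Option (Fin n), (∃ b, σ b = none) → g σ = 0)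
    (hcb : cbNorm g ≤ 1) :
    ∃ (b : Fin d) (i : Fin n), varB g ^ 2 ≤ inflB g b i := by
  obtain ⟨d, rfl⟩ := Nat.exists_eq_succ_of_ne_zero hd.ne'
  have : Nonempty (Fin n) := ⟨⟨0, hn⟩⟩
  obtain ⟨i, hi⟩ := Finite.exists_max (inflB g 0)
  have hnonneg : 0 ≤ varB g := sum_nonneg fun _ _ => sq_nonneg _
  have hinfl : 0 ≤ inflB g 0 i := sum_nonneg fun _ _ => sq_nonneg _
  refine ⟨0, i, (Real.le_sqrt hnonneg hinfl).1 (le_of_forall_gt_imp_ge_of_dense fun r hr => ?_)⟩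
  have hr₀ : 0 < r := (Real.sqrt_nonneg _).trans_lt hr
  exact varB_le_of_inflB_le g hhom hcb hr₀ fun j =>
    (hi j).trans ((Real.sqrt_le_left hr₀.le).1 hr.le)
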